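/- arXiv:1103.1965 — 8 statements merged into one kernel-verified Lean document; each statement's English description precedes it below -/
import Mathlib

section
/- Let I ⊂ ℝ be an interval, let f : I → ℝ be a P-function (i.e. f is nonnegative and f(λx+(1-λ)y) ≤ f(x)+f(y) for all x,y ∈ I and λ ∈ [0,1]), let a,b ∈ I with a < b, and assume f is Lebesgue integrable on [a,b]. Then f((a+b)/2) ≤ (2/(b-a)) ∫_a^b f(x) dx ≤ 2(f(a)+f(b)). -/
open MeasureTheory intervalIntegral

/-- Hermite–Hadamard type inequality for P-functions (Dragomir et al.). -/
theorem hermite_hadamard_P_function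
    (I : Set ℝ) (hI : I.OrdConnected) (f : ℝ → ℝ)
    (hnonneg : ∀ x ∈ I, 0 ≤ f x)
    (hP : ∀ x ∈ I, ∀ y ∈ I, ∀ t ∈ Set.Icc (0:ℝ) 1,
      f (t * x + (1 - t) * y) ≤ f x + f y)
    (a b : ℝ) (ha : a ∈ I) (hb : b ∈ I) (hab : a < b)
    (hint : IntegrableOn f (Set.Icc a b)) :
    f ((a + b) / 2) ≤ (2 / (b - a)) * ∫ x in a..b, f x ∧
      (2 / (b - a)) * ∫ x in a..b, f x ≤ 2 * (f a + f b) := by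
  have hba : 0 < b - a := sub_pos.mpr hab
  have hf : IntervalIntegrable f volume a b :=
    (intervalIntegrable_iff_integrableOn_Icc_of_le hab.le).mpr hint
  have hg : IntervalIntegrable (fun x => f (a + b - x)) volume a b := by
    simpa using (hf.comp_sub_left (a + b)).symm
  have hreflect : ∫ x in a..b, f (a + b - x) = ∫ x in a..b, f x := by
    simp [integral_comp_sub_left]
  have hmid : ∀ x ∈ Set.Icc a b, f ((a + b) / 2) ≤ f x + f (a + b - x) := by
    intro x hx
    have hy : a + b - x ∈ Set.Icc a b := ⟨by linarith [hx.2], by linarith [hx.1]⟩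
    convert hP x (hI.out ha hb hx) (a + b - x) (hI.out ha hb hy) (1 / 2)
      ⟨by norm_num, by norm_num⟩ using 2
    ring
  have hend : ∀ x ∈ Set.Icc a b, f x ≤ f a + f b := by
    intro x hx
    convert hP a ha b hb ((b - x) / (b - a))
      ⟨div_nonneg (by linarith [hx.2]) hba.le,
        (div_le_one hba).mpr (by linarith [hx.1])⟩ using 2
    field_simp
    ring
  have hlower := integral_mono_on hab.le intervalIntegrable_const (hf.add hg) hmid
  have hupper := integral_mono_on hab.le hf intervalIntegrable_const hend
  rw [integral_add hf hg, hreflect, intervalIntegral.integral_const, smul_eq_mul] at hlower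
  rw [intervalIntegral.integral_const, smul_eq_mul] at hupper
  rw [div_mul_eq_mul_div, le_div_iff₀ hba, div_le_iff₀ hba]
  constructor <;> linarith
end

section
/- Let I ⊂ ℝ be an interval and let f : I → ℝ be continuous on I and twice differentiable on the interior I° of I, let a,b ∈ I° with a < b, and suppose there exist real numbers k, K with k ≤ f''(t) ≤ K for all t in the interior of I. Then (k/3)·((b-a)/2)² ≤ (f(a)+f(b))/2 − (1/(b-a)) ∫_a^b f(x) dx ≤ (K/3)·((b-a)/2)². -/
open MeasureTheory intervalIntegral

/-- A function whose second derivative is bounded below by `k` lies below its chord by at least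
`k / 2 * (x - a) * (b - x)`. -/
theorem le_chord_sub_of_le_second_deriv {f f' f'' : ℝ → ℝ} {k a b : ℝ}
    (hcont : ContinuousOn f (Set.Icc a b))
    (hf' : ∀ x ∈ Set.Ioo a b, HasDerivAt f (f' x) x)
    (hf'' : ∀ x ∈ Set.Ioo a b, HasDerivAt f' (f'' x) x)
    (hk : ∀ x ∈ Set.Ioo a b, k ≤ f'' x) (hab : a < b) {x : ℝ} (hx : x ∈ Set.Icc a b) :
    f x ≤ ((b - x) * f a + (x - a) * f b) / (b - a) - k / 2 * ((x - a) * (b - x)) := by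
  have hconv : ConvexOn ℝ (Set.Icc a b) (fun x => f x - k / 2 * x ^ 2) := by
    refine convexOn_of_hasDerivWithinAt2_nonneg (f' := fun x => f' x - k * x)
      (f'' := fun x => f'' x - k) (convex_Icc a b) (by fun_prop) ?_ ?_ ?_ <;>
      rw [interior_Icc] <;> intro y hy
    · refine HasDerivAt.hasDerivWithinAt ?_
      refine ((hf' y hy).sub ((hasDerivAt_pow 2 y).const_mul (k / 2))).congr_deriv ?_
      norm_num
      ring
    · refine HasDerivAt.hasDerivWithinAt ?_
      refine ((hf'' y hy).sub ((hasDerivAt_id y).const_mul k)).congr_deriv ?_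
      ring
    · exact sub_nonneg.2 (hk y hy)
  have hba : 0 < b - a := sub_pos.2 hab
  have h := hconv.2 (Set.left_mem_Icc.2 hab.le) (Set.right_mem_Icc.2 hab.le)
    (div_nonneg (sub_nonneg.2 hx.2) hba.le) (div_nonneg (sub_nonneg.2 hx.1) hba.le)
    (by field_simp; ring)
  have hcomb : (b - x) / (b - a) * a + (x - a) / (b - a) * b = x := by
    field_simp
    ring
  simp only [smul_eq_mul, hcomb] at h
  refine (sub_le_iff_le_add.1 h).trans_eq ?_
  field_simp
  ring

/-- Lower trapezoid bound for a function whose second derivative is bounded below. -/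
theorem trapezoid_lower_bound_second_deriv {f f' f'' : ℝ → ℝ} {k a b : ℝ}
    (hcont : ContinuousOn f (Set.Icc a b))
    (hf' : ∀ x ∈ Set.Ioo a b, HasDerivAt f (f' x) x)
    (hf'' : ∀ x ∈ Set.Ioo a b, HasDerivAt f' (f'' x) x)
    (hk : ∀ x ∈ Set.Ioo a b, k ≤ f'' x) (hab : a < b) :
    k / 3 * ((b - a) / 2) ^ 2 ≤ (f a + f b) / 2 - (1 / (b - a)) * ∫ x in a..b, f x := by
  have hba : 0 < b - a := sub_pos.2 hab
  have hchord : ∫ x in a..b,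
      (((b - x) * f a + (x - a) * f b) / (b - a) - k / 2 * ((x - a) * (b - x))) =
        (b - a) * ((f a + f b) / 2 - k / 3 * ((b - a) / 2) ^ 2) := by
    rw [integral_eq_sub_of_hasDerivAt (f := fun x =>
      ((x - a) ^ 2 * f b - (b - x) ^ 2 * f a) / (2 * (b - a)) -
        k / 2 * ((b - a) * (x - a) ^ 2 / 2 - (x - a) ^ 3 / 3))]
    · field_simp
      ring
    · intro x _
      have hxa : HasDerivAt (fun x => x - a) 1 x := (hasDerivAt_id x).sub_const a
      have hbx : HasDerivAt (fun x => b - x) (-1) x := (hasDerivAt_id x).const_sub b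
      refine (((((hxa.pow 2).mul_const (f b)).sub ((hbx.pow 2).mul_const (f a))).div_const
        (2 * (b - a))).sub (((((hxa.pow 2).const_mul (b - a)).div_const 2).sub
          ((hxa.pow 3).div_const 3)).const_mul (k / 2))).congr_deriv ?_
      field_simp
      norm_num
      ring
    · exact Continuous.intervalIntegrable (by fun_prop) a b
  have hle := integral_mono_on (μ := volume) hab.le (hcont.intervalIntegrable_of_Icc hab.le)
    (Continuous.intervalIntegrable (by fun_prop) a b)
    (fun x hx => le_chord_sub_of_le_second_deriv hcont hf' hf'' hk hab hx)
  rw [hchord, ← div_le_iff₀' hba] at hle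
  rw [one_div_mul_eq_div]
  linarith

/-- Trapezoid bounds for twice differentiable functions with bounded second
derivative (Dragomir–Pearce). -/
theorem trapezoid_bounds_second_deriv
    (I : Set ℝ) (hI : I.OrdConnected) (f f' f'' : ℝ → ℝ)
    (hcont : ContinuousOn f I)
    (hf' : ∀ x ∈ interior I, HasDerivAt f (f' x) x)
    (hf'' : ∀ x ∈ interior I, HasDerivAt f' (f'' x) x)
    (k K : ℝ)
    (hk : ∀ t ∈ interior I, k ≤ f'' t)
    (hK : ∀ t ∈ interior I, f'' t ≤ K)
    (a b : ℝ) (ha : a ∈ interior I) (hb : b ∈ interior I) (hab : a < b) :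
    k / 3 * ((b - a) / 2) ^ 2 ≤ (f a + f b) / 2 - (1 / (b - a)) * ∫ x in a..b, f x ∧
      (f a + f b) / 2 - (1 / (b - a)) * ∫ x in a..b, f x ≤ K / 3 * ((b - a) / 2) ^ 2 := by
  have hsub : Set.Icc a b ⊆ interior I := hI.interior.out ha hb
  have hIoo : Set.Ioo a b ⊆ interior I := Set.Ioo_subset_Icc_self.trans hsub
  have hc : ContinuousOn f (Set.Icc a b) := hcont.mono (hsub.trans interior_subset)
  refine ⟨trapezoid_lower_bound_second_deriv hc (fun x hx => hf' x (hIoo hx))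
    (fun x hx => hf'' x (hIoo hx)) (fun x hx => hk x (hIoo hx)) hab, ?_⟩
  have h := trapezoid_lower_bound_second_deriv (k := -K) hc.neg
    (fun x hx => (hf' x (hIoo hx)).neg) (fun x hx => (hf'' x (hIoo hx)).neg)
    (fun x hx => neg_le_neg (hK x (hIoo hx))) hab
  simp only [Pi.neg_apply, intervalIntegral.integral_neg] at h
  linarith
end

section
/- Let f : [a,b] → ℝ be twice differentiable on (a,b) with a < b, and suppose γ ≤ f''(t) ≤ Γ for all t ∈ (a,b). Then γ(b-a)²/24 ≤ (1/(b-a)) ∫_a^b f(x) dx − f((a+b)/2) ≤ Γ(b-a)²/24. -/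
open MeasureTheory intervalIntegral

/-- Second-order Taylor lower bound on an open interval. -/
lemma taylor_two_le_of_le_second_deriv {a b k : ℝ} {f f' f'' : ℝ → ℝ}
    (hf' : ∀ t ∈ Set.Ioo a b, HasDerivAt f (f' t) t)
    (hf'' : ∀ t ∈ Set.Ioo a b, HasDerivAt f' (f'' t) t)
    (hk : ∀ t ∈ Set.Ioo a b, k ≤ f'' t) {m x : ℝ}
    (hm : m ∈ Set.Ioo a b) (hx : x ∈ Set.Ioo a b) :
    f m + f' m * (x - m) + k / 2 * (x - m) ^ 2 ≤ f x := by
  have hg' : ∀ t ∈ Set.Ioo a b,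
      HasDerivAt (fun t => f t - k / 2 * (t - m) ^ 2) (f' t - k * (t - m)) t := by
    intro t ht
    have h := (hf' t ht).sub ((((hasDerivAt_id t).sub_const m).pow 2).const_mul (k / 2))
    refine h.congr_deriv ?_
    simp
    ring
  have hg'' : ∀ t ∈ Set.Ioo a b,
      HasDerivAt (fun t => f' t - k * (t - m)) (f'' t - k) t := by
    intro t ht
    have h := (hf'' t ht).sub (((hasDerivAt_id t).sub_const m).const_mul k)
    exact h.congr_deriv (by simp)
  have hconv : ConvexOn ℝ (Set.Ioo a b) (fun t => f t - k / 2 * (t - m) ^ 2) := by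
    apply convexOn_of_hasDerivWithinAt2_nonneg (f' := fun t => f' t - k * (t - m))
      (f'' := fun t => f'' t - k) (convex_Ioo a b)
    · exact fun t ht => (hg' t ht).continuousAt.continuousWithinAt
    · exact fun t ht => (hg' t (interior_subset ht)).hasDerivWithinAt
    · exact fun t ht => (hg'' t (interior_subset ht)).hasDerivWithinAt
    · exact fun t ht => sub_nonneg.2 (hk t (interior_subset ht))
  have hd := hg' m hm
  rcases lt_trichotomy m x with h | rfl | h
  · have := hconv.le_slope_of_hasDerivAt hm hx h hd
    rw [slope_def_field, le_div_iff₀ (sub_pos.2 h)] at this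
    simp only [sub_self] at this
    nlinarith
  · simp
  · have := hconv.slope_le_of_hasDerivAt hx hm h hd
    rw [slope_def_field, div_le_iff₀ (sub_pos.2 h)] at this
    simp only [sub_self] at this
    nlinarith

/-- The integral of a quadratic polynomial centred at the midpoint of the interval. -/
lemma integral_quadratic_midpoint (a b p q k : ℝ) :
    ∫ x in a..b, (p + q * (x - (a + b) / 2) + k / 2 * (x - (a + b) / 2) ^ 2) =
      (b - a) * (p + k * (b - a) ^ 2 / 24) := by
  rw [integral_comp_sub_right (fun y => p + q * y + k / 2 * y ^ 2),
    integral_add (Continuous.intervalIntegrable (by fun_prop) _ _)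
      (Continuous.intervalIntegrable (by fun_prop) _ _),
    integral_add (Continuous.intervalIntegrable (by fun_prop) _ _)
      (Continuous.intervalIntegrable (by fun_prop) _ _)]
  rw [intervalIntegral.integral_const_mul q (fun y => y), intervalIntegral.integral_const_mul,
    intervalIntegral.integral_const, integral_id, integral_pow, smul_eq_mul]
  push_cast
  ring

/-- Midpoint bounds for twice differentiable functions with bounded second
derivative (Cerone–Dragomir). -/
theorem midpoint_bounds_second_deriv
    (a b : ℝ) (hab : a < b) (f f' f'' : ℝ → ℝ)
    (hf' : ∀ t ∈ Set.Ioo a b, HasDerivAt f (f' t) t)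
    (hf'' : ∀ t ∈ Set.Ioo a b, HasDerivAt f' (f'' t) t)
    (γ Γ : ℝ)
    (hγ : ∀ t ∈ Set.Ioo a b, γ ≤ f'' t)
    (hΓ : ∀ t ∈ Set.Ioo a b, f'' t ≤ Γ) :
    γ * (b - a) ^ 2 / 24 ≤ (1 / (b - a)) * (∫ x in a..b, f x) - f ((a + b) / 2) ∧
      (1 / (b - a)) * (∫ x in a..b, f x) - f ((a + b) / 2) ≤ Γ * (b - a) ^ 2 / 24 := by
  have hm : (a + b) / 2 ∈ Set.Ioo a b := ⟨by linarith, by linarith⟩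
  let Q : ℝ → ℝ → ℝ := fun k x => f ((a + b) / 2) + f' ((a + b) / 2) * (x - (a + b) / 2) +
    k / 2 * (x - (a + b) / 2) ^ 2
  have hQ : ∀ k, IntervalIntegrable (Q k) volume a b := fun k =>
    Continuous.intervalIntegrable (by fun_prop) _ _
  have hlow : ∀ x ∈ Set.Ioo a b, Q γ x ≤ f x := fun x hx =>
    taylor_two_le_of_le_second_deriv hf' hf'' hγ hm hx
  have hupp : ∀ x ∈ Set.Ioo a b, f x ≤ Q Γ x := by
    intro x hx
    have h := taylor_two_le_of_le_second_deriv (f := fun t => -f t) (f' := fun t => -f' t)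
      (f'' := fun t => -f'' t) (k := -Γ) (fun t ht => (hf' t ht).neg)
      (fun t ht => (hf'' t ht).neg) (fun t ht => neg_le_neg (hΓ t ht)) hm hx
    simp only [Q]
    linarith
  have hfi : IntervalIntegrable f volume a b := by
    have hc : ContinuousOn f (Set.Ioo a b) :=
      fun t ht => (hf' t ht).continuousAt.continuousWithinAt
    rw [intervalIntegrable_iff_integrableOn_Ioo_of_le hab.le]
    exact integrable_of_le_of_le (hc.aestronglyMeasurable measurableSet_Ioo)
      (ae_restrict_of_forall_mem measurableSet_Ioo hlow)
      (ae_restrict_of_forall_mem measurableSet_Ioo hupp)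
      ((intervalIntegrable_iff_integrableOn_Ioo_of_le hab.le).1 (hQ γ))
      ((intervalIntegrable_iff_integrableOn_Ioo_of_le hab.le).1 (hQ Γ))
  have h₁ := integral_mono_on_of_le_Ioo hab.le (hQ γ) hfi hlow
  have h₂ := integral_mono_on_of_le_Ioo hab.le hfi (hQ Γ) hupp
  simp only [Q, integral_quadratic_midpoint] at h₁ h₂
  have hpos : 0 < b - a := sub_pos.2 hab
  rw [one_div_mul_eq_div, le_sub_iff_add_le, sub_le_iff_le_add, le_div_iff₀ hpos, div_le_iff₀ hpos]
  constructor <;> linarith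
end

section
/- Let I ⊂ ℝ be an open interval, a, b ∈ I with a < b, and let f : I → ℝ be twice differentiable with f'' integrable on [a,b]. Let 0 ≤ λ ≤ 1 and define k : [0,1] → ℝ by k(t) = (1/2)t(t−λ) for 0 ≤ t ≤ 1/2 and k(t) = (1/2)(1−t)(1−λ−t) for 1/2 ≤ t ≤ 1. Then (λ−1) f((a+b)/2) − λ (f(a)+f(b))/2 + (1/(b-a)) ∫_a^b f(x) dx = (b-a)² ∫_0^1 k(t) f''(ta+(1−t)b) dt. -/
open MeasureTheory intervalIntegral

/-- Integrating by parts twice against the quadratic `t ^ 2 / 2 + p * t + q`. -/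
theorem integral_quadratic_mul_deriv_deriv {c d : ℝ} (p q : ℝ) {g g' g'' : ℝ → ℝ}
    (hg : ∀ t ∈ Set.uIcc c d, HasDerivAt g (g' t) t)
    (hg' : ∀ t ∈ Set.uIcc c d, HasDerivAt g' (g'' t) t)
    (hint : IntervalIntegrable g'' volume c d) :
    ∫ t in c..d, (t ^ 2 / 2 + p * t + q) * g'' t
      = (d ^ 2 / 2 + p * d + q) * g' d - (c ^ 2 / 2 + p * c + q) * g' c
        - ((d + p) * g d - (c + p) * g c) + ∫ t in c..d, g t := by
  have hquad : ∀ t ∈ Set.uIcc c d,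
      HasDerivAt (fun t : ℝ ↦ t ^ 2 / 2 + p * t + q) (t + p) t := fun t _ ↦ by
    have h := ((((hasDerivAt_id t).pow 2).div_const 2).add
      ((hasDerivAt_id t).const_mul p)).add_const q
    refine h.congr_deriv ?_
    simp
  have hlin : ∀ t ∈ Set.uIcc c d, HasDerivAt (fun t : ℝ ↦ t + p) 1 t :=
    fun t _ ↦ (hasDerivAt_id t).add_const p
  have hcont : ContinuousOn g' (Set.uIcc c d) := HasDerivAt.continuousOn hg'
  rw [integral_mul_deriv_eq_deriv_mul hquad hg'
      ((continuous_id.add continuous_const).intervalIntegrable _ _) hint,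
    integral_mul_deriv_eq_deriv_mul hlin hg intervalIntegrable_const hcont.intervalIntegrable]
  simp only [one_mul]
  ring

/-- Sarıkaya et al.'s identity for twice differentiable mappings. -/
theorem sarikaya_identity
    (I : Set ℝ) (hI : IsOpen I) (hI' : I.OrdConnected)
    (a b : ℝ) (ha : a ∈ I) (hb : b ∈ I) (hab : a < b)
    (f f' f'' : ℝ → ℝ)
    (hf' : ∀ x ∈ I, HasDerivAt f (f' x) x)
    (hf'' : ∀ x ∈ I, HasDerivAt f' (f'' x) x)
    (hint : IntegrableOn f'' (Set.Icc a b))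
    (l : ℝ) (hl0 : 0 ≤ l) (hl1 : l ≤ 1)
    (k : ℝ → ℝ)
    (hk1 : ∀ t, 0 ≤ t → t ≤ 1 / 2 → k t = 1 / 2 * t * (t - l))
    (hk2 : ∀ t, 1 / 2 ≤ t → t ≤ 1 → k t = 1 / 2 * (1 - t) * (1 - l - t)) :
    (l - 1) * f ((a + b) / 2) - l * (f a + f b) / 2 + (1 / (b - a)) * ∫ x in a..b, f x
      = (b - a) ^ 2 * ∫ t in (0:ℝ)..1, k t * f'' (t * a + (1 - t) * b) := by
  have hba : b - a ≠ 0 := (sub_pos.2 hab).ne'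
  have hpath : ∀ t : ℝ, t * a + (1 - t) * b = b - (b - a) * t := fun t ↦ by ring
  simp only [hpath]
  set g : ℝ → ℝ := fun t ↦ f (b - (b - a) * t) with hg_def
  set g' : ℝ → ℝ := fun t ↦ -(b - a) * f' (b - (b - a) * t)
  set g'' : ℝ → ℝ := fun t ↦ (b - a) ^ 2 * f'' (b - (b - a) * t) with hg''_def
  have hmem : ∀ t ∈ Set.Icc (0 : ℝ) 1, b - (b - a) * t ∈ I := fun t ht ↦
    hI'.out ha hb ⟨by nlinarith [ht.2], by nlinarith [ht.1]⟩
  have hinner : ∀ t : ℝ, HasDerivAt (fun t ↦ b - (b - a) * t) (-(b - a)) t := fun t ↦ by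
    simpa using ((hasDerivAt_id t).const_mul (b - a)).const_sub b
  have hg : ∀ t ∈ Set.Icc (0 : ℝ) 1, HasDerivAt g (g' t) t := fun t ht ↦
    ((hf' _ (hmem t ht)).comp t (hinner t)).congr_deriv (mul_comm _ _)
  have hg' : ∀ t ∈ Set.Icc (0 : ℝ) 1, HasDerivAt g' (g'' t) t := fun t ht ↦
    (((hf'' _ (hmem t ht)).comp t (hinner t)).const_mul (-(b - a))).congr_deriv (by
      simp only [hg''_def]; ring)
  have hg''_int : IntervalIntegrable g'' volume 0 1 := by
    have h : IntervalIntegrable f'' volume b a :=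
      ((intervalIntegrable_iff_integrableOn_Icc_of_le hab.le).2 hint).symm
    have h' := ((h.comp_sub_left b).comp_mul_left (c := b - a)).const_mul ((b - a) ^ 2)
    simpa [hba] using h'
  have hleft : Set.uIcc (0 : ℝ) (1 / 2) ⊆ Set.Icc 0 1 := by
    rw [Set.uIcc_of_le (by norm_num)]
    exact Set.Icc_subset_Icc le_rfl (by norm_num)
  have hright : Set.uIcc (1 / 2 : ℝ) 1 ⊆ Set.Icc 0 1 := by
    rw [Set.uIcc_of_le (by norm_num)]
    exact Set.Icc_subset_Icc (by norm_num) le_rfl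
  have hunit : Set.uIcc (0 : ℝ) 1 = Set.Icc 0 1 := Set.uIcc_of_le zero_le_one
  have hint_left := hg''_int.mono_set (hunit ▸ hleft)
  have hint_right := hg''_int.mono_set (hunit ▸ hright)
  have hk_left : Set.EqOn (fun t ↦ (t ^ 2 / 2 + -(l / 2) * t + 0) * g'' t)
      (fun t ↦ k t * g'' t) (Set.uIcc 0 (1 / 2)) := fun t ht ↦ by
    rw [Set.uIcc_of_le (by norm_num)] at ht
    simp only [hk1 t ht.1 ht.2]
    ring
  have hk_right : Set.EqOn (fun t ↦ (t ^ 2 / 2 + (l / 2 - 1) * t + (1 - l) / 2) * g'' t)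
      (fun t ↦ k t * g'' t) (Set.uIcc (1 / 2) 1) := fun t ht ↦ by
    rw [Set.uIcc_of_le (by norm_num)] at ht
    simp only [hk2 t ht.1 ht.2]
    ring
  have hkint_left : IntervalIntegrable (fun t ↦ k t * g'' t) volume 0 (1 / 2) :=
    (intervalIntegrable_congr (hk_left.mono Set.uIoc_subset_uIcc)).1
      (hint_left.continuousOn_mul (by fun_prop))
  have hkint_right : IntervalIntegrable (fun t ↦ k t * g'' t) volume (1 / 2) 1 :=
    (intervalIntegrable_congr (hk_right.mono Set.uIoc_subset_uIcc)).1
      (hint_right.continuousOn_mul (by fun_prop))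
  have hgcont : ContinuousOn g (Set.Icc 0 1) := HasDerivAt.continuousOn hg
  have hsum : (∫ t in (0 : ℝ)..(1 / 2), g t) + ∫ t in (1 / 2 : ℝ)..1, g t
      = 1 / (b - a) * ∫ x in a..b, f x := by
    rw [integral_add_adjacent_intervals (hgcont.mono hleft).intervalIntegrable
      (hgcont.mono hright).intervalIntegrable, hg_def, integral_comp_sub_mul f hba]
    simp
  have hmid : g (1 / 2) = f ((a + b) / 2) := congrArg f (by ring)
  have hzero : g 0 = f b := congrArg f (by ring)
  have hone : g 1 = f a := congrArg f (by ring)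
  calc _ = (∫ t in (0 : ℝ)..(1 / 2), k t * g'' t) + ∫ t in (1 / 2 : ℝ)..1, k t * g'' t := by
        rw [← integral_congr hk_left, ← integral_congr hk_right,
          integral_quadratic_mul_deriv_deriv _ _ (fun t ht ↦ hg t (hleft ht))
            (fun t ht ↦ hg' t (hleft ht)) hint_left,
          integral_quadratic_mul_deriv_deriv _ _ (fun t ht ↦ hg t (hright ht))
            (fun t ht ↦ hg' t (hright ht)) hint_right,
          ← hsum, hmid, hzero, hone]
        ring
    _ = ∫ t in (0 : ℝ)..1, k t * g'' t :=
        integral_add_adjacent_intervals hkint_left hkint_right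
    _ = _ := by
        rw [← intervalIntegral.integral_const_mul]
        exact integral_congr fun t _ ↦ mul_left_comm _ _ _
end

section
/- Let I ⊂ ℝ be an open interval, a,b ∈ I with a < b, let f : I → ℝ be twice differentiable with f'' integrable on [a,b], and suppose |f''| is a P-function on [a,b] (i.e. |f''| is nonnegative and |f''|(λx+(1-λ)y) ≤ |f''|(x)+|f''|(y) for all x,y ∈ [a,b], λ ∈ [0,1]). Let 0 ≤ λ ≤ 1. Then |(λ−1) f((a+b)/2) − λ (f(a)+f(b))/2 + (1/(b-a)) ∫_a^b f(x) dx| is bounded above by ((b-a)²/24)(8λ³ − 3λ + 1)(|f''(a)| + |f''(b)|) when 0 ≤ λ ≤ 1/2, and by ((b-a)²/24)(3λ − 1)(|f''(a)| + |f''(b)|) when 1/2 ≤ λ ≤ 1. -/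
open MeasureTheory intervalIntegral

/-- Twofold integration by parts against the monic quadratic with roots `e` and `e + s`. -/
lemma integral_quadratic_mul_second_deriv {c d e s : ℝ} {f f' f'' : ℝ → ℝ}
    (hf' : ∀ x ∈ Set.uIcc c d, HasDerivAt f (f' x) x)
    (hf'' : ∀ x ∈ Set.uIcc c d, HasDerivAt f' (f'' x) x)
    (hint : IntervalIntegrable f'' volume c d) :
    ∫ x in c..d, (x - e) * (x - e - s) * f'' x =
      (d - e) * (d - e - s) * f' d - (c - e) * (c - e - s) * f' c
        - ((2 * (d - e) - s) * f d - (2 * (c - e) - s) * f c) + 2 * ∫ x in c..d, f x := by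
  have hp : ∀ x ∈ Set.uIcc c d,
      HasDerivAt (fun x : ℝ => (x - e) * (x - e - s)) (2 * (x - e) - s) x := by
    intro x _
    have h1 : HasDerivAt (fun x : ℝ => x - e) 1 x := (hasDerivAt_id x).sub_const e
    exact (h1.mul (h1.sub_const s)).congr_deriv (by ring)
  have hp' : ∀ x ∈ Set.uIcc c d, HasDerivAt (fun x : ℝ => 2 * (x - e) - s) 2 x := by
    intro x _
    simpa using (((hasDerivAt_id x).sub_const e).const_mul 2).sub_const s
  have hf'int : IntervalIntegrable f' volume c d :=
    ContinuousOn.intervalIntegrable fun x hx => (hf'' x hx).continuousAt.continuousWithinAt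
  rw [integral_mul_deriv_eq_deriv_mul hp hf''
      (Continuous.intervalIntegrable (by fun_prop) _ _) hint,
    integral_mul_deriv_eq_deriv_mul hp' hf'
      (Continuous.intervalIntegrable (by fun_prop) _ _) hf'int,
    intervalIntegral.integral_const_mul]
  ring

lemma abs_integral_mul_le_of_abs_le {c d M : ℝ} (hcd : c ≤ d) {p g : ℝ → ℝ}
    (hp : Continuous p) (hg : ∀ x ∈ Set.Icc c d, |g x| ≤ M) :
    |∫ x in c..d, p x * g x| ≤ M * ∫ x in c..d, |p x| := by
  rw [← intervalIntegral.integral_const_mul, ← Real.norm_eq_abs]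
  refine norm_integral_le_of_norm_le hcd (ae_of_all _ fun x hx => ?_)
    (Continuous.intervalIntegrable (by fun_prop) _ _)
  rw [Real.norm_eq_abs, abs_mul, mul_comm]
  exact mul_le_mul_of_nonneg_right (hg x (Set.Ioc_subset_Icc_self hx)) (abs_nonneg _)

lemma integral_mul_sub (c d s : ℝ) :
    ∫ x in c..d, x * (x - s) = (d ^ 3 - c ^ 3) / 3 - s * (d ^ 2 - c ^ 2) / 2 := by
  have h : ∀ x ∈ Set.uIcc c d,
      HasDerivAt (fun x : ℝ => x ^ 3 / 3 - s * x ^ 2 / 2) (x * (x - s)) x := by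
    intro x _
    refine (((hasDerivAt_pow 3 x).div_const 3).sub
      (((hasDerivAt_pow 2 x).const_mul s).div_const 2)).congr_deriv ?_
    norm_num
    ring
  rw [integral_eq_sub_of_hasDerivAt h (Continuous.intervalIntegrable (by fun_prop) _ _)]
  ring

lemma integral_abs_mul_sub_of_le {k s : ℝ} (hk : 0 ≤ k) (hs : k ≤ s) :
    ∫ x in 0..k, |x * (x - s)| = s * k ^ 2 / 2 - k ^ 3 / 3 := by
  have h : ∫ x in 0..k, |x * (x - s)| = ∫ x in 0..k, -(x * (x - s)) := by
    refine integral_congr fun x hx => ?_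
    rw [Set.uIcc_of_le hk] at hx
    exact abs_of_nonpos (mul_nonpos_of_nonneg_of_nonpos hx.1 (by linarith [hx.2]))
  rw [h, intervalIntegral.integral_neg, integral_mul_sub]
  ring

lemma integral_abs_mul_sub_of_ge {k s : ℝ} (hs : 0 ≤ s) (hk : s ≤ k) :
    ∫ x in 0..k, |x * (x - s)| = s ^ 3 / 3 + k ^ 3 / 3 - s * k ^ 2 / 2 := by
  have h : ∫ x in s..k, |x * (x - s)| = ∫ x in s..k, x * (x - s) := by
    refine integral_congr fun x hx => ?_
    rw [Set.uIcc_of_le hk] at hx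
    exact abs_of_nonneg (mul_nonneg (hs.trans hx.1) (by linarith [hx.1]))
  rw [← integral_add_adjacent_intervals (b := s)
      (Continuous.intervalIntegrable (by fun_prop) _ _)
      (Continuous.intervalIntegrable (by fun_prop) _ _),
    integral_abs_mul_sub_of_le hs le_rfl, h, integral_mul_sub]
  ring

/-- A three-point quadrature error is controlled by a uniform bound on the second derivative
and the `L¹` norm of its Peano kernel. -/
lemma abs_three_point_error_le {a b M l : ℝ} (hab : a < b) {f f' f'' : ℝ → ℝ}
    (hf' : ∀ x ∈ Set.Icc a b, HasDerivAt f (f' x) x)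
    (hf'' : ∀ x ∈ Set.Icc a b, HasDerivAt f' (f'' x) x)
    (hint : IntegrableOn f'' (Set.Icc a b)) (hM : ∀ x ∈ Set.Icc a b, |f'' x| ≤ M) :
    |(l - 1) * f ((a + b) / 2) - l * (f a + f b) / 2 + (1 / (b - a)) * ∫ x in a..b, f x|
      ≤ M * (∫ x in 0..(b - a) / 2, |x * (x - l * (b - a))|) / (b - a) := by
  obtain ⟨m, hm⟩ : ∃ m, m = (a + b) / 2 := ⟨_, rfl⟩
  have ham : a ≤ m := by linarith
  have hmb : m ≤ b := by linarith
  have hleft : Set.Icc a m ⊆ Set.Icc a b := Set.Icc_subset_Icc_right hmb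
  have hright : Set.Icc m b ⊆ Set.Icc a b := Set.Icc_subset_Icc_left ham
  have hcont : ContinuousOn f (Set.Icc a b) := fun x hx =>
    (hf' x hx).continuousAt.continuousWithinAt
  have hsplit : (∫ x in a..m, f x) + ∫ x in m..b, f x = ∫ x in a..b, f x :=
    integral_add_adjacent_intervals
      ((hcont.mono hleft).intervalIntegrable_of_Icc ham)
      ((hcont.mono hright).intervalIntegrable_of_Icc hmb)
  have hL := integral_quadratic_mul_second_deriv (c := a) (d := m) (e := a) (s := l * (b - a))
    (f := f) (f' := f') (f'' := f'')
    (by rw [Set.uIcc_of_le ham]; exact fun x hx => hf' x (hleft hx))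
    (by rw [Set.uIcc_of_le ham]; exact fun x hx => hf'' x (hleft hx))
    ((intervalIntegrable_iff_integrableOn_Icc_of_le ham).2 (hint.mono_set hleft))
  have hR := integral_quadratic_mul_second_deriv (c := m) (d := b) (e := b) (s := -(l * (b - a)))
    (f := f) (f' := f') (f'' := f'')
    (by rw [Set.uIcc_of_le hmb]; exact fun x hx => hf' x (hright hx))
    (by rw [Set.uIcc_of_le hmb]; exact fun x hx => hf'' x (hright hx))
    ((intervalIntegrable_iff_integrableOn_Icc_of_le hmb).2 (hint.mono_set hright))
  have hLle := abs_integral_mul_le_of_abs_le (p := fun x => (x - a) * (x - a - l * (b - a)))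
    ham (by fun_prop) fun x hx => hM x (hleft hx)
  have hRle := abs_integral_mul_le_of_abs_le (p := fun x => (x - b) * (x - b - -(l * (b - a))))
    hmb (by fun_prop) fun x hx => hM x (hright hx)
  have hLker : ∫ x in a..m, |(x - a) * (x - a - l * (b - a))| =
      ∫ x in 0..(b - a) / 2, |x * (x - l * (b - a))| := by
    rw [integral_comp_sub_right (fun x => |x * (x - l * (b - a))|) a, sub_self,
      show m - a = (b - a) / 2 by rw [hm]; ring]
  have hRker : ∫ x in m..b, |(x - b) * (x - b - -(l * (b - a)))| =
      ∫ x in 0..(b - a) / 2, |x * (x - l * (b - a))| := by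
    have hreflect := integral_comp_sub_left (a := m) (b := b)
      (fun x => |x * (x - l * (b - a))|) b
    rw [sub_self, show b - m = (b - a) / 2 by rw [hm]; ring] at hreflect
    rw [← hreflect]
    refine integral_congr fun x _ => ?_
    congr 1
    ring
  rw [hLker] at hLle
  rw [hRker] at hRle
  have hpos : 0 < b - a := sub_pos.2 hab
  have hrepr : (l - 1) * f m - l * (f a + f b) / 2 + (1 / (b - a)) * ∫ x in a..b, f x =
      ((∫ x in a..m, (x - a) * (x - a - l * (b - a)) * f'' x) +
        ∫ x in m..b, (x - b) * (x - b - -(l * (b - a))) * f'' x) / (2 * (b - a)) := by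
    rw [hL, hR, ← hsplit, hm]
    field_simp
    ring
  rw [← hm, hrepr, abs_div, abs_of_pos (by positivity : 0 < 2 * (b - a)),
    div_le_div_iff₀ (by positivity) hpos]
  have htotal := (abs_add_le _ _).trans (add_le_add hLle hRle)
  nlinarith [mul_le_mul_of_nonneg_right htotal hpos.le]

/-- Theorem 4 (main result): bound when |f''| is a P-function. -/
theorem bound_P_convex_second_deriv
    (I : Set ℝ) (hI : IsOpen I) (hI' : I.OrdConnected)
    (a b : ℝ) (ha : a ∈ I) (hb : b ∈ I) (hab : a < b)
    (f f' f'' : ℝ → ℝ)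
    (hf' : ∀ x ∈ I, HasDerivAt f (f' x) x)
    (hf'' : ∀ x ∈ I, HasDerivAt f' (f'' x) x)
    (hint : IntegrableOn f'' (Set.Icc a b))
    (hnonneg : ∀ x ∈ Set.Icc a b, 0 ≤ |f'' x|)
    (hP : ∀ x ∈ Set.Icc a b, ∀ y ∈ Set.Icc a b, ∀ t ∈ Set.Icc (0:ℝ) 1,
      |f'' (t * x + (1 - t) * y)| ≤ |f'' x| + |f'' y|)
    (l : ℝ) (hl0 : 0 ≤ l) (hl1 : l ≤ 1) :
    (l ≤ 1 / 2 →
      |(l - 1) * f ((a + b) / 2) - l * (f a + f b) / 2 + (1 / (b - a)) * ∫ x in a..b, f x|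
        ≤ (b - a) ^ 2 / 24 * (8 * l ^ 3 - 3 * l + 1) * (|f'' a| + |f'' b|)) ∧
    (1 / 2 ≤ l →
      |(l - 1) * f ((a + b) / 2) - l * (f a + f b) / 2 + (1 / (b - a)) * ∫ x in a..b, f x|
        ≤ (b - a) ^ 2 / 24 * (3 * l - 1) * (|f'' a| + |f'' b|)) := by
  have hsub : Set.Icc a b ⊆ I := hI'.out ha hb
  have hpos : 0 < b - a := sub_pos.2 hab
  have hM : ∀ x ∈ Set.Icc a b, |f'' x| ≤ |f'' a| + |f'' b| := by
    intro x hx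
    have h := hP a (Set.left_mem_Icc.2 hab.le) b (Set.right_mem_Icc.2 hab.le)
      ((b - x) / (b - a))
      ⟨div_nonneg (by linarith [hx.2]) hpos.le, (div_le_one hpos).2 (by linarith [hx.1])⟩
    convert h using 3
    field_simp
    ring
  have herr := abs_three_point_error_le (l := l) hab (fun x hx => hf' x (hsub hx))
    (fun x hx => hf'' x (hsub hx)) hint hM
  refine ⟨fun hl => herr.trans_eq ?_, fun hl => herr.trans_eq ?_⟩
  · rw [integral_abs_mul_sub_of_ge (by positivity) (by nlinarith)]
    field_simp
    ring
  · rw [integral_abs_mul_sub_of_le (by positivity) (by nlinarith)]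
    field_simp
    ring
end

section
/- Let I ⊂ ℝ be an open interval, a,b ∈ I with a < b, let f : I → ℝ be twice differentiable with f'' integrable on [a,b], let q ≥ 1, and suppose |f''|^q is a P-function on [a,b]. Then |(1/3)[(f(a)+f(b))/2 + 2 f((a+b)/2)] − (1/(b-a)) ∫_a^b f(x) dx| ≤ ((b-a)²/162)(|f''(a)|^q + |f''(b)|^q)^{1/q}. -/
open MeasureTheory intervalIntegral

/-- Weighted mean value theorem for `∫ p f''` with the monic quadratic weight
`p x = (x - r) * (x - s)`, after integrating by parts twice. -/
lemma exists_quadratic_weighted_mean_value {F f f' f'' : ℝ → ℝ} {c d : ℝ} (r s : ℝ) (hcd : c < d)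
    (hF : ∀ x ∈ Set.Icc c d, HasDerivAt F (f x) x)
    (hf : ∀ x ∈ Set.Icc c d, HasDerivAt f (f' x) x)
    (hf' : ∀ x ∈ Set.Icc c d, HasDerivAt f' (f'' x) x)
    (hne : ∀ x ∈ Set.Ioo c d, (x - r) * (x - s) ≠ 0) :
    ∃ ξ ∈ Set.Ioo c d,
      ((d - r) * (d - s) * f' d - (2 * d - r - s) * f d + 2 * F d)
        - ((c - r) * (c - s) * f' c - (2 * c - r - s) * f c + 2 * F c)
      = f'' ξ * ((d ^ 3 / 3 - (r + s) * d ^ 2 / 2 + r * s * d)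
        - (c ^ 3 / 3 - (r + s) * c ^ 2 / 2 + r * s * c)) := by
  have hG : ∀ x ∈ Set.Icc c d, HasDerivAt
      (fun x => (x - r) * (x - s) * f' x - (2 * x - r - s) * f x + 2 * F x)
      ((x - r) * (x - s) * f'' x) x := by
    intro x hx
    have hid := hasDerivAt_id' x
    have h := (((((hid.sub_const r).mul (hid.sub_const s)).mul (hf' x hx)).sub
      ((((hid.const_mul 2).sub_const r).sub_const s).mul (hf x hx))).add
      ((hF x hx).const_mul 2))
    refine h.congr_deriv ?_
    simp only [Pi.mul_apply]
    ring
  have hP : ∀ x, HasDerivAt (fun x => x ^ 3 / 3 - (r + s) * x ^ 2 / 2 + r * s * x)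
      ((x - r) * (x - s)) x := by
    intro x
    have h := ((((hasDerivAt_pow 3 x).div_const 3).sub
      (((hasDerivAt_pow 2 x).const_mul (r + s)).div_const 2)).add
      ((hasDerivAt_id' x).const_mul (r * s)))
    refine h.congr_deriv ?_
    norm_num
    ring
  obtain ⟨ξ, hξ, h⟩ := exists_ratio_hasDerivAt_eq_ratio_slope _ _ hcd
    (fun x hx => (hG x hx).continuousAt.continuousWithinAt)
    (fun x hx => hG x (Set.Ioo_subset_Icc_self hx)) _ _
    (fun x _ => (hP x).continuousAt.continuousWithinAt) (fun x _ => hP x)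
  exact ⟨ξ, hξ, mul_right_cancel₀ (hne ξ hξ) (by linarith)⟩

/-- The error of Simpson's rule as a combination of four values of the second derivative. -/
lemma exists_simpson_error_eq {F f f' f'' : ℝ → ℝ} {a b : ℝ} (hab : a < b)
    (hF : ∀ x ∈ Set.Icc a b, HasDerivAt F (f x) x)
    (hf : ∀ x ∈ Set.Icc a b, HasDerivAt f (f' x) x)
    (hf' : ∀ x ∈ Set.Icc a b, HasDerivAt f' (f'' x) x) :
    ∃ w x y z, a ≤ w ∧ w ≤ x ∧ x ≤ y ∧ y ≤ z ∧ z ≤ b ∧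
      (1 / 3) * ((f a + f b) / 2 + 2 * f ((a + b) / 2)) - (1 / (b - a)) * (F b - F a)
        = (b - a) ^ 2 / 324 * (f'' w - f'' x - f'' y + f'' z) := by
  have mean : ∀ (c d r s : ℝ), a ≤ c → d ≤ b → c < d →
      (∀ x ∈ Set.Ioo c d, (x - r) * (x - s) ≠ 0) → _ := fun c d r s hc hd hcd hne =>
    exists_quadratic_weighted_mean_value r s hcd
      (fun x hx => hF x ⟨hc.trans hx.1, hx.2.trans hd⟩)
      (fun x hx => hf x ⟨hc.trans hx.1, hx.2.trans hd⟩)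
      (fun x hx => hf' x ⟨hc.trans hx.1, hx.2.trans hd⟩) hne
  obtain ⟨w, hw, ew⟩ := mean a ((2 * a + b) / 3) a ((2 * a + b) / 3)
    (by linarith) (by linarith) (by linarith) fun x hx =>
      mul_ne_zero (by linarith [hx.1] : 0 < x - a).ne' (sub_neg.2 hx.2).ne
  obtain ⟨x, hx, ex⟩ := mean ((2 * a + b) / 3) ((a + b) / 2) a ((2 * a + b) / 3)
    (by linarith) (by linarith) (by linarith) fun x hx =>
      mul_ne_zero (by linarith [hx.1] : 0 < x - a).ne' (sub_pos.2 hx.1).ne'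
  obtain ⟨y, hy, ey⟩ := mean ((a + b) / 2) ((a + 2 * b) / 3) ((a + 2 * b) / 3) b
    (by linarith) (by linarith) (by linarith) fun x hx =>
      mul_ne_zero (sub_neg.2 hx.2).ne (by linarith [hx.2] : x - b < 0).ne
  obtain ⟨z, hz, ez⟩ := mean ((a + 2 * b) / 3) b ((a + 2 * b) / 3) b
    (by linarith) (by linarith) (by linarith) fun x hx =>
      mul_ne_zero (sub_pos.2 hx.1).ne' (sub_neg.2 hx.2).ne
  refine ⟨w, x, y, z, hw.1.le, (hw.2.trans hx.1).le, (hx.2.trans hy.1).le,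
    (hy.2.trans hz.1).le, hz.2.le, ?_⟩
  have hba : b - a ≠ 0 := (sub_pos.2 hab).ne'
  apply mul_left_cancel₀ (mul_ne_zero two_ne_zero hba)
  have e : 2 * (b - a) * (1 / 3 * ((f a + f b) / 2 + 2 * f ((a + b) / 2))
      - 1 / (b - a) * (F b - F a))
      = 2 * (b - a) / 3 * ((f a + f b) / 2 + 2 * f ((a + b) / 2)) - 2 * (F b - F a) := by
    field_simp
  rw [e]
  linear_combination -ew - ex - ey - ez

/-- If a derivative `g` vanishes at `z` and `|g|` is at most its value at the far endpoint on every
segment issuing from a zero, then moving away from `z` it keeps its sign and grows in size. -/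
lemma sign_and_monotone_away_from_zero {h g : ℝ → ℝ} {s : Set ℝ} (hs : s.OrdConnected)
    (hg : ∀ x ∈ s, HasDerivAt h (g x) x)
    (hle : ∀ x ∈ s, ∀ y ∈ s, ∀ w ∈ Set.uIcc x y, g x = 0 → |g w| ≤ |g y|)
    {x y z : ℝ} (hx : x ∈ Set.uIcc z y) (hz : z ∈ s) (hy : y ∈ s) (hgz : g z = 0) :
    (0 ≤ g x ∧ g x ≤ g y) ∨ (g y ≤ g x ∧ g x ≤ 0) := by
  have hxs : x ∈ s := hs.uIcc_subset hz hy hx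
  have hxy := hle z hz y hy x hx hgz
  by_cases hzero : ∃ w ∈ Set.uIcc x y, g w = 0
  · obtain ⟨w, hw, hgw⟩ := hzero
    have hxw : x ∈ Set.uIcc z w := by
      rw [Set.mem_uIcc] at *
      grind
    have := hle z hz w (hs.uIcc_subset hxs hy hw) x hxw hgz
    have hgx : g x = 0 := by simpa [hgw] using this
    rcases le_total 0 (g y) with h0 | h0 <;> simp [hgx, h0]
  · push Not at hzero
    rcases hasDerivWithinAt_forall_lt_or_forall_gt_of_forall_ne (convex_uIcc x y)
      (fun w hw => (hg w (hs.uIcc_subset hxs hy hw)).hasDerivWithinAt) hzero with h0 | h0 <;>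
    have hx0 := h0 x Set.left_mem_uIcc <;> have hy0 := h0 y Set.right_mem_uIcc
    · rw [abs_of_neg hx0, abs_of_neg hy0] at hxy
      exact Or.inr ⟨by linarith, hx0.le⟩
    · rw [abs_of_pos hx0, abs_of_pos hy0] at hxy
      exact Or.inl ⟨hx0.le, hxy⟩

/-- Bound on the alternating combination of values of a derivative arising in Simpson's rule. -/
lemma abs_simpson_combination_le {h g : ℝ → ℝ} {a b M : ℝ}
    (hg : ∀ x ∈ Set.Icc a b, HasDerivAt h (g x) x)
    (hle : ∀ x ∈ Set.Icc a b, ∀ y ∈ Set.Icc a b, ∀ w ∈ Set.uIcc x y, g x = 0 → |g w| ≤ |g y|)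
    (hM : ∀ x ∈ Set.Icc a b, |g x| ≤ M) {w x y z : ℝ}
    (haw : a ≤ w) (hwx : w ≤ x) (hxy : x ≤ y) (hyz : y ≤ z) (hzb : z ≤ b) :
    |g w - g x - g y + g z| ≤ 2 * M := by
  have hMw := abs_le.1 (hM w ⟨haw, by linarith⟩)
  have hMx := abs_le.1 (hM x ⟨by linarith, by linarith⟩)
  have hMy := abs_le.1 (hM y ⟨by linarith, by linarith⟩)
  have hMz := abs_le.1 (hM z ⟨by linarith, hzb⟩)
  by_cases hzero : ∃ c ∈ Set.Icc a b, g c = 0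
  · obtain ⟨c, hc, hgc⟩ := hzero
    have right : ∀ u v, c ≤ u → u ≤ v → v ≤ b →
        (0 ≤ g u ∧ g u ≤ g v) ∨ (g v ≤ g u ∧ g u ≤ 0) := fun u v hcu huv hvb =>
      sign_and_monotone_away_from_zero Set.ordConnected_Icc hg hle
        (Set.mem_uIcc.2 (Or.inl ⟨hcu, huv⟩)) hc ⟨by linarith [hc.1], hvb⟩ hgc
    have left : ∀ u v, u ≤ c → v ≤ u → a ≤ v →
        (0 ≤ g u ∧ g u ≤ g v) ∨ (g v ≤ g u ∧ g u ≤ 0) := fun u v huc hvu hav =>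
      sign_and_monotone_away_from_zero Set.ordConnected_Icc hg hle
        (Set.mem_uIcc.2 (Or.inr ⟨hvu, huc⟩)) hc ⟨hav, by linarith [hc.2]⟩ hgc
    rw [abs_le]
    rcases le_total x c with hxc | hxc
    · have h₁ := left x w hxc hwx haw
      rcases le_total y c with hyc | hyc
      · have h₂ := left y x hyc hxy (by linarith)
        grind
      · have h₂ := right y z hyc hyz hzb
        grind
    · have h₁ := right x y hxc hxy (by linarith)
      have h₂ := right y z (by linarith) hyz hzb
      grind
  · push Not at hzero
    rw [abs_le]
    rcases hasDerivWithinAt_forall_lt_or_forall_gt_of_forall_ne (convex_Icc a b)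
      (fun x hx => (hg x hx).hasDerivWithinAt) hzero with h0 | h0 <;>
    · have h₁ := h0 w ⟨haw, by linarith⟩
      have h₂ := h0 x ⟨by linarith, by linarith⟩
      have h₃ := h0 y ⟨by linarith, by linarith⟩
      have h₄ := h0 z ⟨by linarith, hzb⟩
      constructor <;> linarith

/-- Corollary 3: Simpson-type bound when |f''|^q is a P-function. -/
theorem simpson_bound_P_convex
    (I : Set ℝ) (hI : IsOpen I) (hI' : I.OrdConnected)
    (a b : ℝ) (ha : a ∈ I) (hb : b ∈ I) (hab : a < b)
    (f f' f'' : ℝ → ℝ)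
    (hf' : ∀ x ∈ I, HasDerivAt f (f' x) x)
    (hf'' : ∀ x ∈ I, HasDerivAt f' (f'' x) x)
    (hint : IntegrableOn f'' (Set.Icc a b))
    (q : ℝ) (hq : 1 ≤ q)
    (hnonneg : ∀ x ∈ Set.Icc a b, 0 ≤ |f'' x| ^ q)
    (hP : ∀ x ∈ Set.Icc a b, ∀ y ∈ Set.Icc a b, ∀ t ∈ Set.Icc (0:ℝ) 1,
      |f'' (t * x + (1 - t) * y)| ^ q ≤ |f'' x| ^ q + |f'' y| ^ q) :
    |(1 / 3) * ((f a + f b) / 2 + 2 * f ((a + b) / 2)) - (1 / (b - a)) * ∫ x in a..b, f x|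
      ≤ (b - a) ^ 2 / 162 * (|f'' a| ^ q + |f'' b| ^ q) ^ (1 / q) := by
  have hq0 : 0 < q := by linarith
  have hsub : Set.Icc a b ⊆ I := hI'.out ha hb
  have hcont : ContinuousOn f I := fun x hx => (hf' x hx).continuousAt.continuousWithinAt
  have hF : ∀ x ∈ Set.Icc a b, HasDerivAt (fun u => ∫ t in a..u, f t) (f x) x := fun x hx =>
    integral_hasDerivAt_right
      ((hcont.mono (hI'.uIcc_subset ha (hsub hx))).intervalIntegrable)
      (hcont.stronglyMeasurableAtFilter hI x (hsub hx)) (hf' x (hsub hx)).continuousAt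
  have hseg : ∀ x ∈ Set.Icc a b, ∀ y ∈ Set.Icc a b, ∀ w ∈ Set.uIcc x y,
      |f'' w| ^ q ≤ |f'' x| ^ q + |f'' y| ^ q := by
    intro x hx y hy w hw
    rw [← segment_eq_uIcc] at hw
    obtain ⟨s, t, hs, ht, hst, rfl⟩ := hw
    obtain rfl : t = 1 - s := by linarith
    exact hP x hx y hy s ⟨hs, by linarith⟩
  have hle : ∀ x ∈ Set.Icc a b, ∀ y ∈ Set.Icc a b, ∀ w ∈ Set.uIcc x y,
      f'' x = 0 → |f'' w| ≤ |f'' y| := by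
    intro x hx y hy w hw h0
    have := hseg x hx y hy w hw
    rw [h0, abs_zero, Real.zero_rpow hq0.ne', zero_add] at this
    exact (Real.rpow_le_rpow_iff (abs_nonneg _) (abs_nonneg _) hq0).1 this
  have hM : ∀ x ∈ Set.Icc a b, |f'' x| ≤ (|f'' a| ^ q + |f'' b| ^ q) ^ (1 / q) := by
    intro x hx
    rw [one_div, Real.le_rpow_inv_iff_of_pos (abs_nonneg _) (by positivity) hq0]
    exact hseg a (Set.left_mem_Icc.2 hab.le) b (Set.right_mem_Icc.2 hab.le) x
      (Set.Icc_subset_uIcc hx)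
  obtain ⟨w, x, y, z, haw, hwx, hxy, hyz, hzb, herr⟩ := exists_simpson_error_eq hab hF
    (fun x hx => hf' x (hsub hx)) (fun x hx => hf'' x (hsub hx))
  rw [integral_same, sub_zero] at herr
  have hcomb := abs_simpson_combination_le (fun x hx => hf'' x (hsub hx)) hle hM
    haw hwx hxy hyz hzb
  rw [herr, abs_mul, abs_of_nonneg (by positivity)]
  calc _ ≤ (b - a) ^ 2 / 324 * (2 * (|f'' a| ^ q + |f'' b| ^ q) ^ (1 / q)) := by gcongr
    _ = _ := by ring
end

section
/- Let I ⊂ ℝ be an open interval, a,b ∈ I with a < b, let f : I → ℝ be twice differentiable with f'' integrable on [a,b], let q ≥ 1, suppose |f''|^q is a P-function on [a,b], and suppose |f''(x)| ≤ M for all x ∈ [a,b] with M > 0. Then |(1/3)[(f(a)+f(b))/2 + 2 f((a+b)/2)] − (1/(b-a)) ∫_a^b f(x) dx| ≤ M (b-a)² 2^{1/q} / 162, and consequently |(1/3)[(f(a)+f(b))/2 + 2 f((a+b)/2)] − (1/(b-a)) ∫_a^b f(x) dx| ≤ M (b-a)² / 81. -/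
open MeasureTheory intervalIntegral

/-- Integrating `k * f''` by parts twice, where `k t = (t - α) * (t - β) / 2` satisfies `k'' = 1`,
gives a bound when `f''` is compared with the constant `s` against the weight `k`. -/
lemma quadratic_kernel_bound {c d α β s : ℝ} {f f' f'' : ℝ → ℝ} (hcd : c ≤ d)
    (hf' : ∀ x ∈ Set.Icc c d, HasDerivAt f (f' x) x)
    (hf'' : ∀ x ∈ Set.Icc c d, HasDerivAt f' (f'' x) x)
    (hint : IntervalIntegrable f'' volume c d)
    (hs : ∀ x ∈ Set.Icc c d, (x - α) * (x - β) * s ≤ (x - α) * (x - β) * f'' x) :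
    s * ((d ^ 3 / 3 - (α + β) * d ^ 2 / 2 + α * β * d) / 2
        - (c ^ 3 / 3 - (α + β) * c ^ 2 / 2 + α * β * c) / 2)
      ≤ ((d - α) * (d - β) / 2 * f' d - (d - (α + β) / 2) * f d)
        - ((c - α) * (c - β) / 2 * f' c - (c - (α + β) / 2) * f c) + ∫ x in c..d, f x := by
  have huIcc : Set.uIcc c d = Set.Icc c d := Set.uIcc_of_le hcd
  have hf : IntervalIntegrable f volume c d := by
    apply ContinuousOn.intervalIntegrable
    rw [huIcc]
    exact fun x hx => (hf' x hx).continuousAt.continuousWithinAt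
  have hk : IntervalIntegrable (fun x => (x - α) * (x - β) / 2 * f'' x) volume c d :=
    hint.continuousOn_mul (by fun_prop)
  have hparts : ∫ x in c..d, ((x - α) * (x - β) / 2 * f'' x - f x)
      = ((d - α) * (d - β) / 2 * f' d - (d - (α + β) / 2) * f d)
        - ((c - α) * (c - β) / 2 * f' c - (c - (α + β) / 2) * f c) := by
    refine integral_eq_sub_of_hasDerivAt
      (f := fun x => (x - α) * (x - β) / 2 * f' x - (x - (α + β) / 2) * f x) ?_ (hk.sub hf)
    intro x hx
    rw [huIcc] at hx
    have hid := hasDerivAt_id' x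
    refine (((((hid.sub_const α).mul (hid.sub_const β)).div_const 2).mul (hf'' x hx)).sub
      ((hid.sub_const ((α + β) / 2)).mul (hf' x hx))).congr_deriv ?_
    simp only [Pi.mul_apply]
    ring
  have hpoly : ∫ x in c..d, (x - α) * (x - β) / 2 * s
      = s * ((d ^ 3 / 3 - (α + β) * d ^ 2 / 2 + α * β * d) / 2)
        - s * ((c ^ 3 / 3 - (α + β) * c ^ 2 / 2 + α * β * c) / 2) := by
    refine integral_eq_sub_of_hasDerivAt
      (f := fun x => s * ((x ^ 3 / 3 - (α + β) * x ^ 2 / 2 + α * β * x) / 2)) ?_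
      (Continuous.intervalIntegrable (by fun_prop) _ _)
    intro x _
    refine ((((((hasDerivAt_pow 3 x).div_const 3).sub
      (((hasDerivAt_pow 2 x).const_mul (α + β)).div_const 2)).add
      ((hasDerivAt_id' x).const_mul (α * β))).div_const 2).const_mul s).congr_deriv ?_
    norm_num
    ring
  have hmono : ∫ x in c..d, (x - α) * (x - β) / 2 * s
      ≤ ∫ x in c..d, (x - α) * (x - β) / 2 * f'' x :=
    integral_mono_on hcd (Continuous.intervalIntegrable (by fun_prop) _ _) hk
      fun x hx => by linarith [hs x hx]
  rw [integral_sub hk hf] at hparts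
  linarith

/-- One-sided Simpson estimate when `f''` is bounded above by `s₁`, below by `s₂` and above by `s₃`
on the three successive thirds of `[a, b]`. -/
lemma simpson_upper_bound_of_thirds {a b s₁ s₂ s₃ : ℝ} {f f' f'' : ℝ → ℝ} (hab : a < b)
    (hf' : ∀ x ∈ Set.Icc a b, HasDerivAt f (f' x) x)
    (hf'' : ∀ x ∈ Set.Icc a b, HasDerivAt f' (f'' x) x)
    (hint : IntegrableOn f'' (Set.Icc a b))
    (h₁ : ∀ x ∈ Set.Icc a b, x ≤ a + (b - a) / 3 → f'' x ≤ s₁)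
    (h₂ : ∀ x ∈ Set.Icc a b, a + (b - a) / 3 ≤ x → x ≤ b - (b - a) / 3 → s₂ ≤ f'' x)
    (h₃ : ∀ x ∈ Set.Icc a b, b - (b - a) / 3 ≤ x → f'' x ≤ s₃) :
    (1 / 3) * ((f a + f b) / 2 + 2 * f ((a + b) / 2)) - (1 / (b - a)) * ∫ x in a..b, f x
      ≤ (b - a) ^ 2 * (s₁ + s₃ - 2 * s₂) / 324 := by
  obtain ⟨h, rfl⟩ : ∃ h, b = a + h := ⟨b - a, by ring⟩
  have hh : 0 < h := by linarith
  have key : ∀ c d α β s : ℝ, a ≤ c → c ≤ d → d ≤ a + h →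
      (∀ x ∈ Set.Icc c d, (x - α) * (x - β) * s ≤ (x - α) * (x - β) * f'' x) → _ :=
    fun c d α β s hac hcd hdb hs =>
      have hsub : Set.Icc c d ⊆ Set.Icc a (a + h) := Set.Icc_subset_Icc hac hdb
      quadratic_kernel_bound hcd (fun x hx => hf' x (hsub hx)) (fun x hx => hf'' x (hsub hx))
        ((intervalIntegrable_iff_integrableOn_Icc_of_le hcd).2 (hint.mono_set hsub)) hs
  have hfi : ∀ c d : ℝ, a ≤ c → c ≤ d → d ≤ a + h → IntervalIntegrable f volume c d := by
    intro c d hac hcd hdb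
    apply ContinuousOn.intervalIntegrable
    rw [Set.uIcc_of_le hcd]
    exact fun x hx => (hf' x ⟨hac.trans hx.1, hx.2.trans hdb⟩).continuousAt.continuousWithinAt
  have e₁ := key a (a + h / 3) a (a + h / 3) s₁ le_rfl (by linarith) (by linarith) <| by
    intro x ⟨hx, hx'⟩
    exact mul_le_mul_of_nonpos_left
      (h₁ x ⟨by linarith, by linarith⟩ (by linarith))
      (mul_nonpos_of_nonneg_of_nonpos (by linarith) (by linarith))
  have e₂ := key (a + h / 3) (a + h / 2) a (a + h / 3) s₂ (by linarith) (by linarith)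
      (by linarith) <| by
    intro x ⟨hx, hx'⟩
    exact mul_le_mul_of_nonneg_left
      (h₂ x ⟨by linarith, by linarith⟩ (by linarith) (by linarith))
      (mul_nonneg (by linarith) (by linarith))
  have e₃ := key (a + h / 2) (a + 2 * h / 3) (a + 2 * h / 3) (a + h) s₂ (by linarith)
      (by linarith) (by linarith) <| by
    intro x ⟨hx, hx'⟩
    exact mul_le_mul_of_nonneg_left
      (h₂ x ⟨by linarith, by linarith⟩ (by linarith) (by linarith))
      (mul_nonneg_of_nonpos_of_nonpos (by linarith) (by linarith))
  have e₄ := key (a + 2 * h / 3) (a + h) (a + 2 * h / 3) (a + h) s₃ (by linarith)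
      (by linarith) (by linarith) <| by
    intro x ⟨hx, hx'⟩
    exact mul_le_mul_of_nonpos_left
      (h₃ x ⟨by linarith, by linarith⟩ (by linarith))
      (mul_nonpos_of_nonneg_of_nonpos (by linarith) (by linarith))
  have i₁ := integral_add_adjacent_intervals
    (hfi a (a + h / 3) le_rfl (by linarith) (by linarith))
    (hfi (a + h / 3) (a + h / 2) (by linarith) (by linarith) (by linarith))
  have i₂ := integral_add_adjacent_intervals
    (hfi (a + h / 2) (a + 2 * h / 3) (by linarith) (by linarith) (by linarith))
    (hfi (a + 2 * h / 3) (a + h) (by linarith) (by linarith) (by linarith))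
  have i₃ := integral_add_adjacent_intervals
    (hfi a (a + h / 2) le_rfl (by linarith) (by linarith))
    (hfi (a + h / 2) (a + h) (by linarith) (by linarith) (by linarith))
  have hmid : (a + (a + h)) / 2 = a + h / 2 := by ring
  rw [hmid, add_sub_cancel_left]
  refine le_of_mul_le_mul_left ?_ hh
  have hcancel : h * (1 / 3 * ((f a + f (a + h)) / 2 + 2 * f (a + h / 2))
        - 1 / h * ∫ x in a..a + h, f x)
      = h * (1 / 3 * ((f a + f (a + h)) / 2 + 2 * f (a + h / 2))) - ∫ x in a..a + h, f x := by
    field_simp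
  rw [hcancel]
  linarith

/-- A real function with the intermediate value property at `0`, whose absolute value grows away
from each of its zeros, is monotone as soon as it takes a negative value before a positive one. -/
lemma monotoneOn_of_abs_le_of_zero {S : Set ℝ} {D : ℝ → ℝ}
    (hzero : ∀ x ∈ S, ∀ y ∈ S, ∀ z ∈ Set.uIcc x y, D x = 0 → |D z| ≤ |D y|)
    (hivt : ∀ x ∈ S, ∀ y ∈ S, D x < 0 → 0 < D y → ∃ w ∈ S, w ∈ Set.uIcc x y ∧ D w = 0)
    {u v : ℝ} (hu : u ∈ S) (hv : v ∈ S) (huv : u < v) (hDu : D u < 0) (hDv : 0 < D v) :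
    MonotoneOn D S := by
  have hbetween : ∀ x ∈ S, ∀ y ∈ S, ∀ z, x ≤ z → z ≤ y → D x = 0 → D y = 0 → D z = 0 := by
    intro x hx y hy z hxz hzy hDx hDy
    have := hzero x hx y hy z (Set.mem_uIcc.2 (Or.inl ⟨hxz, hzy⟩)) hDx
    simpa [hDy] using this
  obtain ⟨w, hw, hwuv, hDw⟩ := hivt u hu v hv hDu hDv
  rw [Set.uIcc_of_le huv.le] at hwuv
  have hleft : ∀ x ∈ S, x ≤ w → D x ≤ 0 := by
    intro x hx hxw
    by_contra! hpos
    obtain ⟨w', hw', hmem, hDw'⟩ := hivt u hu x hx hDu hpos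
    rcases Set.mem_uIcc.1 hmem with hm | hm
    · exact hpos.ne' (hbetween w' hw' w hw x hm.2 hxw hDw' hDw)
    · exact hDu.ne (hbetween w' hw' w hw u hm.2 hwuv.1 hDw' hDw)
  have hright : ∀ x ∈ S, w ≤ x → 0 ≤ D x := by
    intro x hx hwx
    by_contra! hneg
    obtain ⟨w', hw', hmem, hDw'⟩ := hivt x hx v hv hneg hDv
    rcases Set.mem_uIcc.1 hmem with hm | hm
    · exact hneg.ne (hbetween w hw w' hw' x hwx hm.1 hDw hDw')
    · exact hDv.ne' (hbetween w hw w' hw' v hwuv.2 hm.1 hDw hDw')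
  intro x hx y hy hxy
  rcases le_total y w with hyw | hwy
  · have := hzero w hw x hx y (Set.mem_uIcc.2 (Or.inr ⟨hxy, hyw⟩)) hDw
    rw [abs_of_nonpos (hleft y hy hyw), abs_of_nonpos (hleft x hx (hxy.trans hyw))] at this
    linarith
  rcases le_total x w with hxw | hwx
  · exact (hleft x hx hxw).trans (hright y hy hwy)
  · have := hzero w hw y hy x (Set.mem_uIcc.2 (Or.inl ⟨hwx, hxy⟩)) hDw
    rwa [abs_of_nonneg (hright x hx hwx), abs_of_nonneg (hright y hy hwy)] at this

/-- If `|D| ^ q` is a P-function and `D` has the intermediate value property at `0`, then `D` has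
constant sign or is monotone. -/
lemma sign_or_monotone_of_P_function {a b q : ℝ} {D : ℝ → ℝ} (hq : 0 < q)
    (hP : ∀ x ∈ Set.Icc a b, ∀ y ∈ Set.Icc a b, ∀ t ∈ Set.Icc (0:ℝ) 1,
      |D (t * x + (1 - t) * y)| ^ q ≤ |D x| ^ q + |D y| ^ q)
    (hivt : ∀ x ∈ Set.Icc a b, ∀ y ∈ Set.Icc a b, D x < 0 → 0 < D y →
      ∃ w ∈ Set.Icc a b, w ∈ Set.uIcc x y ∧ D w = 0) :
    (∀ x ∈ Set.Icc a b, 0 ≤ D x) ∨ (∀ x ∈ Set.Icc a b, D x ≤ 0) ∨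
      MonotoneOn D (Set.Icc a b) ∨ AntitoneOn D (Set.Icc a b) := by
  have hzero : ∀ x ∈ Set.Icc a b, ∀ y ∈ Set.Icc a b, ∀ z ∈ Set.uIcc x y,
      D x = 0 → |D z| ≤ |D y| := by
    intro x hx y hy z hz hDx
    rw [← segment_eq_uIcc] at hz
    obtain ⟨t, r, ht, hr, htr, rfl⟩ := hz
    obtain rfl : r = 1 - t := by linarith
    have := hP x hx y hy t ⟨ht, by linarith⟩
    rw [hDx, abs_zero, Real.zero_rpow hq.ne', zero_add] at this
    exact (Real.rpow_le_rpow_iff (abs_nonneg _) (abs_nonneg _) hq).1 this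
  by_contra! hcon
  obtain ⟨⟨u, hu, hDu⟩, ⟨v, hv, hDv⟩, hmono, hanti⟩ := hcon
  rcases lt_trichotomy u v with huv | rfl | hvu
  · exact hmono (monotoneOn_of_abs_le_of_zero hzero hivt hu hv huv hDu hDv)
  · exact lt_asymm hDu hDv
  · have hneg : MonotoneOn (fun x => -D x) (Set.Icc a b) := by
      refine monotoneOn_of_abs_le_of_zero (by simpa using hzero) ?_ hv hu hvu
        (neg_lt_zero.2 hDv) (neg_pos.2 hDu)
      intro x hx y hy hDx hDy
      obtain ⟨w, hw, hmem, hDw⟩ := hivt y hy x hx (neg_pos.1 hDy) (neg_lt_zero.1 hDx)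
      exact ⟨w, hw, Set.uIcc_comm y x ▸ hmem, by simp [hDw]⟩
    exact hanti fun x hx y hy hxy => neg_le_neg_iff.1 (hneg hx hy hxy)

/-- One-sided Simpson estimate when `f''` has constant sign or is monotone. -/
lemma simpson_upper_bound_of_sign_or_monotone {a b M : ℝ} {f f' f'' : ℝ → ℝ} (hab : a < b)
    (hf' : ∀ x ∈ Set.Icc a b, HasDerivAt f (f' x) x)
    (hf'' : ∀ x ∈ Set.Icc a b, HasDerivAt f' (f'' x) x)
    (hint : IntegrableOn f'' (Set.Icc a b))
    (hbound : ∀ x ∈ Set.Icc a b, |f'' x| ≤ M)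
    (hcases : (∀ x ∈ Set.Icc a b, 0 ≤ f'' x) ∨ (∀ x ∈ Set.Icc a b, f'' x ≤ 0) ∨
      MonotoneOn f'' (Set.Icc a b) ∨ AntitoneOn f'' (Set.Icc a b)) :
    (1 / 3) * ((f a + f b) / 2 + 2 * f ((a + b) / 2)) - (1 / (b - a)) * ∫ x in a..b, f x
      ≤ M * (b - a) ^ 2 / 162 := by
  have hupper : ∀ x ∈ Set.Icc a b, f'' x ≤ M := fun x hx => (abs_le.1 (hbound x hx)).2
  have hlower : ∀ x ∈ Set.Icc a b, -M ≤ f'' x := fun x hx => (abs_le.1 (hbound x hx)).1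
  have hp : a + (b - a) / 3 ∈ Set.Icc a b := ⟨by linarith, by linarith⟩
  have hp' : b - (b - a) / 3 ∈ Set.Icc a b := ⟨by linarith, by linarith⟩
  suffices hthirds : ∃ s₁ s₂ s₃ : ℝ, s₁ + s₃ - 2 * s₂ ≤ 2 * M ∧
      (∀ x ∈ Set.Icc a b, x ≤ a + (b - a) / 3 → f'' x ≤ s₁) ∧
      (∀ x ∈ Set.Icc a b, a + (b - a) / 3 ≤ x → x ≤ b - (b - a) / 3 → s₂ ≤ f'' x) ∧
      (∀ x ∈ Set.Icc a b, b - (b - a) / 3 ≤ x → f'' x ≤ s₃) by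
    obtain ⟨s₁, s₂, s₃, hs, h₁, h₂, h₃⟩ := hthirds
    have := simpson_upper_bound_of_thirds hab hf' hf'' hint h₁ h₂ h₃
    linarith [mul_le_mul_of_nonneg_left hs (sq_nonneg (b - a))]
  rcases hcases with h | h | h | h
  · exact ⟨M, 0, M, by linarith, fun x hx _ => hupper x hx, fun x hx _ _ => h x hx,
      fun x hx _ => hupper x hx⟩
  · exact ⟨0, -M, 0, by linarith, fun x hx _ => h x hx, fun x hx _ _ => hlower x hx,
      fun x hx _ => h x hx⟩
  · exact ⟨f'' (a + (b - a) / 3), f'' (a + (b - a) / 3), M, by linarith [hlower _ hp],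
      fun x hx hxp => h hx hp hxp, fun x hx hpx _ => h hp hx hpx, fun x hx _ => hupper x hx⟩
  · exact ⟨M, f'' (b - (b - a) / 3), f'' (b - (b - a) / 3), by linarith [hlower _ hp'],
      fun x hx _ => hupper x hx, fun x hx _ hxp => h hx hp' hxp, fun x hx hpx => h hp' hx hpx⟩

/-- Corollary 8: Simpson-type bound when |f''| is bounded by M. -/
theorem simpson_bound_P_convex_bounded
    (I : Set ℝ) (hI : IsOpen I) (hI' : I.OrdConnected)
    (a b : ℝ) (ha : a ∈ I) (hb : b ∈ I) (hab : a < b)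
    (f f' f'' : ℝ → ℝ)
    (hf' : ∀ x ∈ I, HasDerivAt f (f' x) x)
    (hf'' : ∀ x ∈ I, HasDerivAt f' (f'' x) x)
    (hint : IntegrableOn f'' (Set.Icc a b))
    (q : ℝ) (hq : 1 ≤ q)
    (hnonneg : ∀ x ∈ Set.Icc a b, 0 ≤ |f'' x| ^ q)
    (hP : ∀ x ∈ Set.Icc a b, ∀ y ∈ Set.Icc a b, ∀ t ∈ Set.Icc (0:ℝ) 1,
      |f'' (t * x + (1 - t) * y)| ^ q ≤ |f'' x| ^ q + |f'' y| ^ q)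
    (M : ℝ) (hM : 0 < M) (hbound : ∀ x ∈ Set.Icc a b, |f'' x| ≤ M) :
    |(1 / 3) * ((f a + f b) / 2 + 2 * f ((a + b) / 2)) - (1 / (b - a)) * ∫ x in a..b, f x|
        ≤ M * (b - a) ^ 2 * 2 ^ (1 / q) / 162 ∧
      |(1 / 3) * ((f a + f b) / 2 + 2 * f ((a + b) / 2)) - (1 / (b - a)) * ∫ x in a..b, f x|
        ≤ M * (b - a) ^ 2 / 81 := by
  have hsub : Set.Icc a b ⊆ I := hI'.out ha hb
  have hivt : ∀ x ∈ Set.Icc a b, ∀ y ∈ Set.Icc a b, f'' x < 0 → 0 < f'' y →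
      ∃ w ∈ Set.Icc a b, w ∈ Set.uIcc x y ∧ f'' w = 0 := by
    intro x hx y hy hDx hDy
    have hxy : Set.uIcc x y ⊆ Set.Icc a b := Set.uIcc_subset_Icc hx hy
    have himage : (f'' '' Set.uIcc x y).OrdConnected :=
      Set.ordConnected_uIcc.image_hasDerivWithinAt
        fun z hz => (hf'' z (hsub (hxy hz))).hasDerivWithinAt
    obtain ⟨w, hw, hDw⟩ := himage.out ⟨x, Set.left_mem_uIcc, rfl⟩ ⟨y, Set.right_mem_uIcc, rfl⟩
      (⟨hDx.le, hDy.le⟩ : (0 : ℝ) ∈ Set.Icc (f'' x) (f'' y))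
    exact ⟨w, hxy hw, hw, hDw⟩
  have hcases := sign_or_monotone_of_P_function (by linarith) hP hivt
  have hupper := simpson_upper_bound_of_sign_or_monotone hab (fun x hx => hf' x (hsub hx))
    (fun x hx => hf'' x (hsub hx)) hint hbound hcases
  have hlower := simpson_upper_bound_of_sign_or_monotone (f := -f) (f' := -f') (f'' := -f'')
    (M := M) hab (fun x hx => (hf' x (hsub hx)).neg) (fun x hx => (hf'' x (hsub hx)).neg)
    hint.neg (by simpa using hbound) <| by
      rcases hcases with h | h | h | h
      · exact Or.inr (Or.inl (by simpa using h))
      · exact Or.inl (by simpa using h)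
      · exact Or.inr (Or.inr (Or.inr h.neg))
      · exact Or.inr (Or.inr (Or.inl h.neg))
  simp only [Pi.neg_apply, intervalIntegral.integral_neg] at hlower
  have habs : |(1 / 3) * ((f a + f b) / 2 + 2 * f ((a + b) / 2))
      - (1 / (b - a)) * ∫ x in a..b, f x| ≤ M * (b - a) ^ 2 / 162 :=
    abs_le.2 ⟨by linarith, hupper⟩
  have hscale : 0 ≤ M * (b - a) ^ 2 := by positivity
  have hpow : (1 : ℝ) ≤ 2 ^ (1 / q) := Real.one_le_rpow (by norm_num) (by positivity)
  exact ⟨by linarith [mul_le_mul_of_nonneg_left hpow hscale], by linarith⟩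
end

section
/- Let a,b ∈ ℝ with 0 < a < b, let n ∈ ℤ with n ∉ {-1, 0} and |n(n-1)| ≥ 3, and let q ≥ 1 be a real number. Then |(1/3) A(a^n, b^n) + (2/3) A^n(a,b) − L_n^n(a,b)| ≤ |n(n-1)| · ((b-a)²/162) · (a^{q(n-2)} + b^{q(n-2)})^{1/q}, where A(x,y) = (x+y)/2 is the arithmetic mean and L_n^n(a,b) = (b^{n+1} − a^{n+1})/((n+1)(b−a)). -/
/-- The Simpson remainder of a function with primitive `F` whose second derivative takes values
in `[0, M]`. -/
theorem abs_simpson_sub_average_le {F f f' f'' : ℝ → ℝ} {a b M : ℝ} (hab : a < b)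
    (hF : ∀ x ∈ Set.Icc a b, HasDerivAt F (f x) x)
    (hf : ∀ x ∈ Set.Icc a b, HasDerivAt f (f' x) x)
    (hf' : ∀ x ∈ Set.Icc a b, HasDerivAt f' (f'' x) x)
    (h0 : ∀ x ∈ Set.Icc a b, 0 ≤ f'' x) (hM : ∀ x ∈ Set.Icc a b, f'' x ≤ M) :
    |(1 / 3) * ((f a + f b) / 2) + (2 / 3) * f ((a + b) / 2) - (F b - F a) / (b - a)|
      ≤ M * ((b - a) ^ 2 / 162) := by
  obtain ⟨m, hm⟩ : ∃ m, m = (a + b) / 2 := ⟨_, rfl⟩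
  obtain ⟨h, hh⟩ : ∃ h, h = (b - a) / 2 := ⟨_, rfl⟩
  have hpos : 0 < h := by linarith
  obtain rfl : a = m - h := by linarith
  obtain rfl : b = m + h := by linarith
  clear hm hh
  -- the Peano kernel of the rule folded about the midpoint
  let k : ℝ → ℝ := fun t => (h - t) * (3 * t - h) / 6
  let K : ℝ → ℝ := fun t => -(t * (h - t) ^ 2) / 6
  let G : ℝ → ℝ := fun t => k t * (f' (m + t) - f' (m - t))
    - (4 * h - 6 * t) / 6 * (f (m + t) + f (m - t)) - (F (m + t) - F (m - t))
  have hK : ∀ t, HasDerivAt K (k t) t := by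
    intro t
    have h1 := (((hasDerivAt_id t).mul (((hasDerivAt_id t).const_sub h).pow 2)).neg).div_const 6
    refine h1.congr_deriv ?_
    simp [k]
    ring
  have hk : ∀ t, HasDerivAt k ((4 * h - 6 * t) / 6) t := by
    intro t
    have h1 := (((hasDerivAt_id t).const_sub h).mul
      (((hasDerivAt_id t).const_mul 3).sub_const h)).div_const 6
    refine h1.congr_deriv ?_
    simp
    ring
  have hG : ∀ t ∈ Set.Icc 0 h, HasDerivAt G (k t * (f'' (m + t) + f'' (m - t))) t := by
    intro t ht
    have mp : m + t ∈ Set.Icc (m - h) (m + h) := ⟨by linarith [ht.1], by linarith [ht.2]⟩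
    have mm : m - t ∈ Set.Icc (m - h) (m + h) := ⟨by linarith [ht.2], by linarith [ht.1]⟩
    have l : HasDerivAt (fun t => (4 * h - 6 * t) / 6) (-1) t := by
      refine ((((hasDerivAt_id t).const_mul 6).const_sub (4 * h)).div_const 6).congr_deriv ?_
      norm_num
    have h1 := (((hk t).mul (((hf' _ mp).comp_const_add m t).sub
      ((hf' _ mm).comp_const_sub m t))).sub (l.mul (((hf _ mp).comp_const_add m t).add
      ((hf _ mm).comp_const_sub m t)))).sub (((hF _ mp).comp_const_add m t).sub
      ((hF _ mm).comp_const_sub m t))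
    refine h1.congr_deriv ?_
    simp
    ring
  have bound : ∀ t ∈ Set.Icc 0 h, 0 ≤ f'' (m + t) + f'' (m - t) ∧
      f'' (m + t) + f'' (m - t) ≤ 2 * M := by
    intro t ht
    have mp : m + t ∈ Set.Icc (m - h) (m + h) := ⟨by linarith [ht.1], by linarith [ht.2]⟩
    have mm : m - t ∈ Set.Icc (m - h) (m + h) := ⟨by linarith [ht.2], by linarith [ht.1]⟩
    exact ⟨by linarith [h0 _ mp, h0 _ mm], by linarith [hM _ mp, hM _ mm]⟩
  have mono : ∀ {g g' : ℝ → ℝ} {x y : ℝ}, x ≤ y → (∀ t ∈ Set.Icc x y, HasDerivAt g (g' t) t) →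
      (∀ t ∈ Set.Icc x y, 0 ≤ g' t) → g x ≤ g y := by
    intro g g' x y hxy hg hg'
    refine monotoneOn_of_hasDerivWithinAt_nonneg (f' := g') (convex_Icc x y)
      (fun t ht => (hg t ht).continuousAt.continuousWithinAt)
      (fun t ht => (hg t (interior_subset ht)).hasDerivWithinAt)
      (fun t ht => hg' t (interior_subset ht)) ⟨le_rfl, hxy⟩ ⟨hxy, le_rfl⟩ hxy
  have left : ∀ t ∈ Set.Icc 0 (h / 3), t ∈ Set.Icc 0 h ∧ k t ≤ 0 := by
    intro t ht
    refine ⟨⟨ht.1, by linarith [ht.2]⟩, ?_⟩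
    have := mul_nonneg (show 0 ≤ h - t by linarith [ht.2]) (show 0 ≤ h - 3 * t by linarith [ht.2])
    simp only [k]
    linarith
  have right : ∀ t ∈ Set.Icc (h / 3) h, t ∈ Set.Icc 0 h ∧ 0 ≤ k t := by
    intro t ht
    refine ⟨⟨by linarith [ht.1], ht.2⟩, ?_⟩
    have := mul_nonneg (show 0 ≤ h - t by linarith [ht.2]) (show 0 ≤ 3 * t - h by linarith [ht.1])
    simp only [k]
    linarith
  have e1 : -G 0 ≤ -G (h / 3) := mono (g := fun t => -G t) (by linarith)
    (fun t ht => (hG t (left t ht).1).neg)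
    (fun t ht => by nlinarith [(left t ht).2, (bound t (left t ht).1).1])
  have e2 : G 0 - 2 * M * K 0 ≤ G (h / 3) - 2 * M * K (h / 3) :=
    mono (g := fun t => G t - 2 * M * K t) (by linarith)
      (fun t ht => (hG t (left t ht).1).sub ((hK t).const_mul (2 * M)))
      (fun t ht => by nlinarith [(left t ht).2, (bound t (left t ht).1).2])
  have e3 : G (h / 3) ≤ G h := mono (by linarith)
    (fun t ht => hG t (right t ht).1)
    (fun t ht => mul_nonneg (right t ht).2 (bound t (right t ht).1).1)
  have e4 : 2 * M * K (h / 3) - G (h / 3) ≤ 2 * M * K h - G h :=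
    mono (g := fun t => 2 * M * K t - G t) (by linarith)
      (fun t ht => ((hK t).const_mul (2 * M)).sub (hG t (right t ht).1))
      (fun t ht => by nlinarith [(right t ht).2, (bound t (right t ht).1).2])
  have E : (1 / 3) * ((f (m - h) + f (m + h)) / 2) + (2 / 3) * f ((m - h + (m + h)) / 2)
      - (F (m + h) - F (m - h)) / (m + h - (m - h)) = (G h - G 0) / (2 * h) := by
    have : (m - h + (m + h)) / 2 = m := by ring
    rw [this, show m + h - (m - h) = 2 * h by ring]
    simp only [G, k, add_zero, sub_zero]
    field_simp
    ring
  rw [E, abs_div, abs_of_pos (show 0 < 2 * h by linarith), div_le_iff₀ (by linarith), abs_le]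
  simp only [K] at e2 e4
  constructor <;> ring_nf at e1 e2 e3 e4 ⊢ <;> linarith

/-- A summand is at most the `q`-norm of a pair of nonnegative numbers. -/
theorem le_rpow_add_rpow_rpow_inv {x y q : ℝ} (hx : 0 ≤ x) (hy : 0 ≤ y) (hq : 0 < q) :
    x ≤ (x ^ q + y ^ q) ^ (1 / q) := by
  calc x = (x ^ q) ^ (1 / q) := by rw [← Real.rpow_mul hx, mul_one_div_cancel hq.ne', Real.rpow_one]
    _ ≤ _ := by
      have := Real.rpow_nonneg hx q
      have := Real.rpow_nonneg hy q
      gcongr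
      linarith

/-- An integer power on a positive interval is bounded by the `q`-norm of its endpoint values. -/
theorem zpow_le_rpow_add_rpow_rpow_inv {a b x q : ℝ} (ha : 0 < a) (hax : a ≤ x) (hxb : x ≤ b)
    (hq : 0 < q) (k : ℤ) :
    x ^ k ≤ (a ^ (q * (k : ℝ)) + b ^ (q * (k : ℝ))) ^ (1 / q) := by
  have hx : 0 < x := ha.trans_le hax
  have hb : 0 < b := hx.trans_le hxb
  have key : ∀ c : ℝ, 0 < c → c ^ (q * (k : ℝ)) = (c ^ k) ^ q := fun c hc => by
    rw [mul_comm, Real.rpow_mul hc.le, Real.rpow_intCast]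
  rw [key a ha, key b hb]
  rcases le_total 0 k with hk | hk
  · rw [add_comm]
    exact (zpow_le_zpow_left₀ hk hx.le hxb).trans
      (le_rpow_add_rpow_rpow_inv (zpow_pos hb k).le (zpow_pos ha k).le hq)
  · refine le_trans ?_ (le_rpow_add_rpow_rpow_inv (zpow_pos ha k).le (zpow_pos hb k).le hq)
    have := zpow_le_zpow_left₀ (neg_nonneg.2 hk) ha.le hax
    rw [zpow_neg, zpow_neg] at this
    exact (inv_le_inv₀ (zpow_pos ha k) (zpow_pos hx k)).1 this

/-- Proposition 3: special-means inequality from Corollary 8. -/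
theorem special_means_simpson
    (a b : ℝ) (ha : 0 < a) (hab : a < b) (n : ℤ)
    (hn1 : n ≠ -1) (hn0 : n ≠ 0) (hn : 3 ≤ |n * (n - 1)|)
    (q : ℝ) (hq : 1 ≤ q) :
    |(1 / 3) * ((a ^ n + b ^ n) / 2) + (2 / 3) * ((a + b) / 2) ^ n
        - (b ^ (n + 1) - a ^ (n + 1)) / (((n : ℝ) + 1) * (b - a))|
      ≤ ((|n * (n - 1)| : ℤ) : ℝ) * ((b - a) ^ 2 / 162) *
        (a ^ (q * ((n : ℝ) - 2)) + b ^ (q * ((n : ℝ) - 2))) ^ (1 / q) := by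
  have hnn : 0 ≤ n * (n - 1) := by
    rcases lt_or_gt_of_ne hn0 with h | h
    · exact mul_nonneg_of_nonpos_of_nonpos h.le (by lia)
    · exact mul_nonneg h.le (by lia)
  have hnR : (0 : ℝ) ≤ n * (n - 1) := by exact_mod_cast hnn
  have hn1R : (n : ℝ) + 1 ≠ 0 := by
    intro h
    exact hn1 (by have : n + 1 = 0 := by exact_mod_cast h
                  lia)
  have hpos : ∀ x ∈ Set.Icc a b, 0 < x := fun x hx => ha.trans_le hx.1
  have main := abs_simpson_sub_average_le (F := fun x => x ^ (n + 1) / ((n : ℝ) + 1))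
    (f := fun x => x ^ n) (f' := fun x => n * x ^ (n - 1))
    (f'' := fun x => n * (n - 1) * x ^ (n - 2))
    (M := n * (n - 1) * (a ^ (q * ((n : ℝ) - 2)) + b ^ (q * ((n : ℝ) - 2))) ^ (1 / q)) hab
    (fun x hx => by
      refine ((hasDerivAt_zpow (n + 1) x (Or.inl (hpos x hx).ne')).div_const _).congr_deriv ?_
      push_cast
      rw [add_sub_cancel_right]
      field_simp)
    (fun x hx => hasDerivAt_zpow n x (Or.inl (hpos x hx).ne'))
    (fun x hx => by
      refine ((hasDerivAt_zpow (n - 1) x (Or.inl (hpos x hx).ne')).const_mul _).congr_deriv ?_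
      rw [show n - 1 - 1 = n - 2 by ring]
      push_cast
      ring)
    (fun x hx => mul_nonneg hnR (zpow_pos (hpos x hx) _).le)
    (fun x hx => mul_le_mul_of_nonneg_left (by
      simpa using zpow_le_rpow_add_rpow_rpow_inv ha hx.1 hx.2 (q := q) (by linarith) (n - 2)) hnR)
  rw [abs_of_nonneg hnn]
  push_cast
  rw [← div_div, sub_div]
  linarith
end
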